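/- Let E, F ⊆ ℤ be two regular compatible sets with D(E) + D(F) > 1. Then for Lebesgue almost every λ ∈ ℝ, the arithmetic sum E + ⌊λF⌋ = {a + ⌊λb⌋ : a ∈ E, b ∈ F} has positive upper-Banach density: d*(E + ⌊λF⌋) > 0. -/

import Mathlib

open Filter MeasureTheory
open scoped ENNReal

noncomputable section

/-- The filter of intervals `(M, N]` of `ℤ` as the length `N - M` tends to infinity.
An interval is encoded by the pair `(M, N)`. -/
def intervalFilter : Filter (ℤ × ℤ) :=
  Filter.comap (fun p : ℤ × ℤ => p.2 - p.1) Filter.atTop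

/-- The number of elements of `E` in the interval `(M, N]`. -/
def icount (E : Set ℤ) (M N : ℤ) : ℕ := (E ∩ Set.Ioc M N).ncard

/-- The counting dimension of `E ⊆ ℤ`:
`D(E) = limsup_{|I| → ∞} log |E ∩ I| / log |I|`. -/
def countingDim (E : Set ℤ) : ℝ :=
  Filter.limsup
    (fun p : ℤ × ℤ => Real.log (icount E p.1 p.2) / Real.log ((p.2 - p.1 : ℤ) : ℝ))
    intervalFilter

/-- The counting `α`-measure of `E ⊆ ℤ`:
`H_α(E) = limsup_{|I| → ∞} |E ∩ I| / |I|^α`, with values in `[0, ∞]`. -/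
def countingMeasure (α : ℝ) (E : Set ℤ) : ℝ≥0∞ :=
  Filter.limsup
    (fun p : ℤ × ℤ =>
      ENNReal.ofReal ((icount E p.1 p.2 : ℝ) / ((p.2 - p.1 : ℤ) : ℝ) ^ α))
    intervalFilter

/-- The upper-Banach density of `E ⊆ ℤ`:
`d*(E) = limsup_{|I| → ∞} |E ∩ I| / |I|`. -/
def upperBanach (E : Set ℤ) : ℝ :=
  Filter.limsup
    (fun p : ℤ × ℤ => (icount E p.1 p.2 : ℝ) / ((p.2 - p.1 : ℤ) : ℝ))
    intervalFilter

/-- `E ⊆ ℤ` is regular if `0 < H_{D(E)}(E) < ∞`. -/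
def Regular (E : Set ℤ) : Prop :=
  0 < countingMeasure (countingDim E) E ∧ countingMeasure (countingDim E) E < ⊤

/-- Two (regular) sets `E, F ⊆ ℤ` are compatible if there are sequences of intervals
`I_n = (a n, b n]`, `J_n = (c n, d n]` with increasing lengths, `|I_n| ≍ |J_n|`,
`|E ∩ I_n| ≫ |I_n|^{D(E)}` and `|F ∩ J_n| ≫ |J_n|^{D(F)}`. -/
def Compatible (E F : Set ℤ) : Prop :=
  ∃ a b c d : ℕ → ℤ,
    (∀ n, a n < b n) ∧ (∀ n, c n < d n) ∧
    StrictMono (fun n => b n - a n) ∧ StrictMono (fun n => d n - c n) ∧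
    (∃ C : ℝ, 0 < C ∧ ∀ n,
      ((b n - a n : ℤ) : ℝ) ≤ C * ((d n - c n : ℤ) : ℝ) ∧
      ((d n - c n : ℤ) : ℝ) ≤ C * ((b n - a n : ℤ) : ℝ)) ∧
    (∃ c₁ : ℝ, 0 < c₁ ∧ ∀ n,
      c₁ * ((b n - a n : ℤ) : ℝ) ^ countingDim E ≤ (icount E (a n) (b n) : ℝ)) ∧
    (∃ c₂ : ℝ, 0 < c₂ ∧ ∀ n,
      c₂ * ((d n - c n : ℤ) : ℝ) ^ countingDim F ≤ (icount F (c n) (d n) : ℝ))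

/-- The arithmetic sum `E + ⌊λ F⌋ = {a + ⌊λ b⌋ : a ∈ E, b ∈ F}`. -/
def sumFloor (E F : Set ℤ) (l : ℝ) : Set ℤ :=
  {n : ℤ | ∃ a ∈ E, ∃ b ∈ F, n = a + ⌊l * (b : ℝ)⌋}

instance intervalFilter_neBot : intervalFilter.NeBot := by
  refine Filter.comap_neBot_iff.2 fun t ht => ?_
  obtain ⟨m, hm⟩ := Filter.mem_atTop_sets.1 ht
  exact ⟨(0, m), hm _ (by simp)⟩

lemma eventually_intervalFilter {P : ℤ × ℤ → Prop} :
    (∀ᶠ p in intervalFilter, P p) ↔ ∃ L : ℤ, ∀ p : ℤ × ℤ, L ≤ p.2 - p.1 → P p := by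
  rw [intervalFilter, Filter.eventually_comap, Filter.eventually_atTop]
  constructor
  · rintro ⟨L, hL⟩
    exact ⟨L, fun p hp => hL _ hp p rfl⟩
  · rintro ⟨L, hL⟩
    exact ⟨L, fun m hm p hp => hL p (hp ▸ hm)⟩

open Classical in
/-- The elements of `E` in the interval `(M, N]`, as a finset. -/
def slice (E : Set ℤ) (M N : ℤ) : Finset ℤ := (Finset.Ioc M N).filter (· ∈ E)

lemma mem_slice {E : Set ℤ} {M N x : ℤ} : x ∈ slice E M N ↔ (M < x ∧ x ≤ N) ∧ x ∈ E := by
  simp [slice]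

lemma icount_eq_card_slice (E : Set ℤ) (M N : ℤ) : icount E M N = (slice E M N).card := by
  rw [icount, ← Set.ncard_coe_finset]
  congr 1
  ext x
  simp [mem_slice, and_comm]

lemma icount_le (E : Set ℤ) {M N : ℤ} (h : M ≤ N) : (icount E M N : ℝ) ≤ ((N - M : ℤ) : ℝ) := by
  have h1 : (slice E M N).card ≤ (N - M).toNat := by
    rw [← Int.card_Ioc]
    exact Finset.card_le_card fun x hx => Finset.mem_Ioc.2 (mem_slice.1 hx).1
  have h2 : ((slice E M N).card : ℤ) ≤ N - M := by omega
  rw [icount_eq_card_slice]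
  exact_mod_cast h2

lemma countingDim_le_one (E : Set ℤ) : countingDim E ≤ 1 := by
  refine Filter.limsup_le_of_le ?_ ?_
  · refine Filter.IsCoboundedUnder.of_frequently_ge (a := 0) (Filter.Eventually.frequently ?_)
    refine eventually_intervalFilter.2 ⟨1, fun p hp => ?_⟩
    have : (1 : ℝ) ≤ ((p.2 - p.1 : ℤ) : ℝ) := by exact_mod_cast hp
    exact div_nonneg (Real.log_natCast_nonneg _) (Real.log_nonneg this)
  · refine eventually_intervalFilter.2 ⟨2, fun p hp => ?_⟩
    have h2 : (2 : ℝ) ≤ ((p.2 - p.1 : ℤ) : ℝ) := by exact_mod_cast hp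
    refine (div_le_one (Real.log_pos (by linarith))).2 ?_
    rcases Nat.eq_zero_or_pos (icount E p.1 p.2) with h | h
    · rw [h]
      simpa using Real.log_nonneg (by linarith : (1 : ℝ) ≤ ((p.2 - p.1 : ℤ) : ℝ))
    · exact Real.log_le_log (by exact_mod_cast h) (icount_le E (by omega))

lemma exists_card_slice_le {E : Set ℤ} {α : ℝ} (hα : 0 ≤ α) (h : countingMeasure α E < ⊤) :
    ∃ K : ℝ, 0 < K ∧ ∀ M N : ℤ, M < N →
      ((slice E M N).card : ℝ) ≤ K * ((N - M : ℤ) : ℝ) ^ α := by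
  obtain ⟨T, hT, hT'⟩ := exists_between h
  obtain ⟨L, hL⟩ := eventually_intervalFilter.1 (Filter.eventually_lt_of_limsup_lt hT)
  refine ⟨max T.toReal (max L 1), by positivity, fun M N hMN => ?_⟩
  have h1 : (1 : ℝ) ≤ ((N - M : ℤ) : ℝ) := by exact_mod_cast (by omega : (1 : ℤ) ≤ N - M)
  have h2 : (1 : ℝ) ≤ ((N - M : ℤ) : ℝ) ^ α := Real.one_le_rpow h1 hα
  rw [← icount_eq_card_slice]
  rcases le_total L (N - M) with hl | hl
  · have h3 := (ENNReal.ofReal_lt_iff_lt_toReal (by positivity) hT'.ne).1 (hL (M, N) hl)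
    simp only at h3
    rw [div_lt_iff₀ (by positivity)] at h3
    exact h3.le.trans (by gcongr; exact le_max_left _ _)
  · have h3 : (icount E M N : ℝ) ≤ L := (icount_le E hMN.le).trans (by exact_mod_cast hl)
    calc (icount E M N : ℝ) ≤ max T.toReal (max L 1) * 1 := by
          rw [mul_one]; exact h3.trans ((le_max_left _ _).trans (le_max_right _ _))
      _ ≤ _ := by gcongr

lemma upperBanach_pos {S : Set ℤ} {u v : ℕ → ℤ} {c : ℝ} (hc : 0 < c)
    (huv : Tendsto (fun n => v n - u n) atTop atTop)
    (h : ∃ᶠ n in atTop, c * ((v n - u n : ℤ) : ℝ) ≤ icount S (u n) (v n)) :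
    0 < upperBanach S := by
  have ht : Tendsto (fun n => (u n, v n)) atTop intervalFilter := Filter.tendsto_comap_iff.2 huv
  refine hc.trans_le (Filter.le_limsup_of_frequently_le (ht.frequently ?_) ?_)
  · refine (h.and_eventually (huv.eventually_ge_atTop 1)).mono fun n hn => ?_
    have : (0 : ℝ) < ((v n - u n : ℤ) : ℝ) := by exact_mod_cast hn.2
    exact (le_div_iff₀ this).2 hn.1
  · refine ⟨1, Filter.eventually_map.2 (eventually_intervalFilter.2 ⟨1, fun p hp => ?_⟩)⟩
    have h1 : (0 : ℝ) < ((p.2 - p.1 : ℤ) : ℝ) := by exact_mod_cast hp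
    exact (div_le_one h1).2 (icount_le S (by omega))

/-- The pairs of points of `P` which have the same image under `f`. -/
def collisions {ι κ : Type*} [DecidableEq κ] (P : Finset ι) (f : ι → κ) : Finset (ι × ι) :=
  (P ×ˢ P).filter fun q => f q.1 = f q.2

lemma card_sq_le_card_image_mul_card_collisions {ι κ : Type*} [DecidableEq κ]
    (P : Finset ι) (f : ι → κ) :
    P.card ^ 2 ≤ (P.image f).card * (collisions P f).card := by
  classical
  have h1 : P.card = ∑ z ∈ P.image f, (P.filter (f · = z)).card :=
    Finset.card_eq_sum_card_image f P
  have h2 : (collisions P f).card = ∑ z ∈ P.image f, (P.filter (f · = z)).card ^ 2 := by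
    rw [Finset.card_eq_sum_card_fiberwise (f := fun q => f q.1) (t := P.image f)]
    · refine Finset.sum_congr rfl fun z _ => ?_
      rw [sq, ← Finset.card_product]
      congr 1
      ext ⟨x, y⟩
      simp only [collisions, Finset.mem_filter, Finset.mem_product]
      constructor
      · rintro ⟨⟨⟨hx, hy⟩, hxy⟩, hz⟩
        exact ⟨⟨hx, hz⟩, hy, hxy ▸ hz⟩
      · rintro ⟨⟨hx, hz⟩, hy, hz'⟩
        exact ⟨⟨⟨hx, hy⟩, hz.trans hz'.symm⟩, hz⟩
    · intro q hq
      simp only [collisions, Finset.coe_filter, Set.mem_ofPred_eq, Finset.mem_product] at hq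
      exact Finset.mem_coe.2 (Finset.mem_image_of_mem _ hq.1.1)
  rw [h1, h2]
  exact sq_sum_le_card_mul_sum_sq

/-- The map `(a, b) ↦ a + ⌊l b⌋`. -/
def addFloor (l : ℝ) (x : ℤ × ℤ) : ℤ := x.1 + ⌊l * (x.2 : ℝ)⌋

lemma measurable_addFloor (x : ℤ × ℤ) : Measurable fun l : ℝ => addFloor l x := by
  unfold addFloor
  fun_prop

lemma measurableSet_addFloor_eq (x y : ℤ × ℤ) :
    MeasurableSet {l : ℝ | addFloor l x = addFloor l y} :=
  measurableSet_eq_fun (measurable_addFloor x) (measurable_addFloor y)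

lemma abs_lt_one_of_addFloor_eq {l : ℝ} {x y : ℤ × ℤ} (h : addFloor l x = addFloor l y) :
    |l * ((x.2 - y.2 : ℤ) : ℝ) - ((y.1 - x.1 : ℤ) : ℝ)| < 1 := by
  have h' : (x.1 : ℝ) + ⌊l * (x.2 : ℝ)⌋ = y.1 + ⌊l * (y.2 : ℝ)⌋ := by exact_mod_cast h
  have h1 := Int.floor_le (l * (x.2 : ℝ))
  have h2 := Int.lt_floor_add_one (l * (x.2 : ℝ))
  have h3 := Int.floor_le (l * (y.2 : ℝ))
  have h4 := Int.lt_floor_add_one (l * (y.2 : ℝ))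
  push_cast
  rw [mul_sub, abs_lt]
  constructor <;> linarith

/-- An upper bound for the measure of the set of `l ∈ [-Λ, Λ]` for which `x` and `y` collide. -/
def collisionWeight (Λ : ℕ) (x y : ℤ × ℤ) : ℝ :=
  if x.2 = y.2 then (if x.1 = y.1 then 2 * (Λ : ℝ) else 0)
  else if |y.1 - x.1| ≤ Λ * |x.2 - y.2| then 2 / ((|x.2 - y.2| : ℤ) : ℝ) else 0

lemma collisionWeight_nonneg (Λ : ℕ) (x y : ℤ × ℤ) : 0 ≤ collisionWeight Λ x y := by
  unfold collisionWeight
  split_ifs <;> positivity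

lemma volume_addFloor_eq_le (Λ : ℕ) (x y : ℤ × ℤ) :
    volume.restrict (Set.Icc (-(Λ : ℝ)) Λ) {l : ℝ | addFloor l x = addFloor l y} ≤
      ENNReal.ofReal (collisionWeight Λ x y) := by
  rw [Measure.restrict_apply (measurableSet_addFloor_eq x y), collisionWeight]
  split_ifs with h2 h1 h3
  · refine (measure_mono Set.inter_subset_right).trans ?_
    rw [Real.volume_Icc]
    exact ENNReal.ofReal_le_ofReal (by linarith)
  · refine (measure_mono_null (t := ∅) ?_ (by simp)).le.trans zero_le
    rintro l ⟨hl, -⟩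
    simp only [Set.mem_ofPred_eq, addFloor, h2, add_left_inj] at hl
    exact h1 hl
  · have hδ : (0 : ℝ) < |((x.2 - y.2 : ℤ) : ℝ)| :=
      abs_pos.2 (by exact_mod_cast sub_ne_zero.2 h2)
    have hsub : {l : ℝ | addFloor l x = addFloor l y} ∩ Set.Icc (-(Λ : ℝ)) Λ ⊆
        Metric.ball (((y.1 - x.1 : ℤ) : ℝ) / ((x.2 - y.2 : ℤ) : ℝ))
          (1 / |((x.2 - y.2 : ℤ) : ℝ)|) := by
      rintro l ⟨hl, -⟩
      have h := abs_lt_one_of_addFloor_eq hl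
      rw [Metric.mem_ball, Real.dist_eq, lt_div_iff₀ hδ, ← abs_mul, sub_mul,
        div_mul_cancel₀ _ (abs_pos.1 hδ)]
      exact h
    refine (measure_mono hsub).trans ?_
    rw [Real.volume_ball]
    refine ENNReal.ofReal_le_ofReal (le_of_eq ?_)
    rw [Int.cast_abs]
    ring
  · refine (measure_mono_null (t := ∅) ?_ (by simp)).le.trans zero_le
    rintro l ⟨hl, hl'⟩
    have h := abs_lt_one_of_addFloor_eq hl
    refine h3 (Int.lt_add_one_iff.1 ?_)
    have hb : |l * ((x.2 - y.2 : ℤ) : ℝ)| ≤ Λ * |((x.2 - y.2 : ℤ) : ℝ)| := by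
      rw [abs_mul]
      gcongr
      exact abs_le.2 hl'
    have : |((y.1 - x.1 : ℤ) : ℝ)| < Λ * |((x.2 - y.2 : ℤ) : ℝ)| + 1 := by
      have := abs_sub_abs_le_abs_sub ((y.1 - x.1 : ℤ) : ℝ) (l * ((x.2 - y.2 : ℤ) : ℝ))
      rw [abs_sub_comm] at this
      linarith
    exact_mod_cast this

lemma card_collisions_eq_sum (P : Finset (ℤ × ℤ)) (l : ℝ) :
    ((collisions P (addFloor l)).card : ℝ≥0∞) =
      ∑ q ∈ P ×ˢ P, {l : ℝ | addFloor l q.1 = addFloor l q.2}.indicator 1 l := by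
  rw [collisions, Finset.card_filter]
  push_cast
  refine Finset.sum_congr rfl fun q _ => ?_
  simp [Set.indicator_apply]

lemma measurable_card_collisions (P : Finset (ℤ × ℤ)) :
    Measurable fun l : ℝ => ((collisions P (addFloor l)).card : ℝ≥0∞) := by
  simp_rw [card_collisions_eq_sum]
  exact Finset.measurable_sum _ fun q _ =>
    measurable_one.indicator (measurableSet_addFloor_eq _ _)

lemma lintegral_card_collisions_le (Λ : ℕ) (P : Finset (ℤ × ℤ)) :
    ∫⁻ l in Set.Icc (-(Λ : ℝ)) Λ, ((collisions P (addFloor l)).card : ℝ≥0∞) ≤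
      ENNReal.ofReal (∑ x ∈ P, ∑ y ∈ P, collisionWeight Λ x y) := by
  simp_rw [card_collisions_eq_sum]
  rw [lintegral_finsetSum _ fun q _ => measurable_one.indicator (measurableSet_addFloor_eq _ _),
    ← Finset.sum_product', ENNReal.ofReal_sum_of_nonneg fun _ _ => collisionWeight_nonneg _ _ _]
  refine Finset.sum_le_sum fun q _ => ?_
  rw [lintegral_indicator_one (measurableSet_addFloor_eq _ _)]
  exact volume_addFloor_eq_le Λ q.1 q.2

lemma sum_collisionWeight_fiber_le {E : Set ℤ} {α K : ℝ} (hα : 0 ≤ α)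
    (hK : ∀ M N : ℤ, M < N → ((slice E M N).card : ℝ) ≤ K * ((N - M : ℤ) : ℝ) ^ α) (hK0 : 0 < K)
    (Λ : ℕ) (M N : ℤ) (x : ℤ × ℤ) {b : ℤ} (hb : x.2 ≠ b) :
    ∑ a ∈ slice E M N, collisionWeight Λ x (a, b) ≤
      2 * K * (2 * Λ + 1 : ℝ) ^ α * ((|x.2 - b| : ℤ) : ℝ) ^ (α - 1) := by
  set m : ℤ := |x.2 - b| with hm
  have hm1 : 1 ≤ m := Int.one_le_abs (sub_ne_zero.2 hb)
  have hm1' : (1 : ℝ) ≤ m := by exact_mod_cast hm1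
  have hΛm : 0 ≤ (Λ : ℤ) * m := by positivity
  simp only [collisionWeight, if_neg hb, ← hm]
  rw [← Finset.sum_filter, Finset.sum_const, nsmul_eq_mul]
  have hsub : (slice E M N).filter (fun a => |a - x.1| ≤ Λ * m) ⊆
      slice E (x.1 - Λ * m - 1) (x.1 + Λ * m) := by
    intro a ha
    rw [Finset.mem_filter, abs_le] at ha
    exact mem_slice.2 ⟨by constructor <;> linarith, (mem_slice.1 ha.1).2⟩
  have hcard : (((slice E M N).filter (fun a => |a - x.1| ≤ Λ * m)).card : ℝ) ≤
      K * ((2 * Λ + 1) * m : ℝ) ^ α := by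
    refine (Nat.cast_le.2 (Finset.card_le_card hsub)).trans ((hK _ _ (by linarith)).trans ?_)
    have h0 : (0 : ℝ) ≤ ((x.1 + Λ * m - (x.1 - Λ * m - 1) : ℤ) : ℝ) := by
      exact_mod_cast (by linarith : (0 : ℤ) ≤ x.1 + Λ * m - (x.1 - Λ * m - 1))
    gcongr
    push_cast
    linarith
  calc _ ≤ K * ((2 * Λ + 1) * m : ℝ) ^ α * (2 / (m : ℝ)) := by gcongr
    _ = _ := by
      rw [Real.mul_rpow (by positivity) (by positivity), Real.rpow_sub_one (by positivity)]
      ring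

lemma geom_sum_le_mul_pow {r : ℝ} (hr : 1 < r) (m : ℕ) :
    ∑ k ∈ Finset.range (m + 1), r ^ k ≤ r / (r - 1) * r ^ m := by
  rw [geom_sum_eq hr.ne', div_mul_eq_mul_div, pow_succ']
  have : 0 < r - 1 := by linarith
  gcongr
  linarith

lemma sum_abs_rpow_le {F : Set ℤ} {α β K : ℝ} (hα : α ≤ 1) (hαβ : 1 < α + β)
    (hK : ∀ M N : ℤ, M < N → ((slice F M N).card : ℝ) ≤ K * ((N - M : ℤ) : ℝ) ^ β) (hK0 : 0 < K) :
    ∃ C : ℝ, 0 < C ∧ ∀ M N : ℤ, ∀ b ∈ slice F M N,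
      ∑ b' ∈ (slice F M N).filter (b ≠ ·), ((|b - b'| : ℤ) : ℝ) ^ (α - 1) ≤
        C * ((N - M : ℤ) : ℝ) ^ (α + β - 1) := by
  set r : ℝ := (2 : ℝ) ^ (α + β - 1) with hr
  have hr1 : 1 < r := Real.one_lt_rpow (by norm_num) (by linarith)
  have hr1' : 0 < r - 1 := by linarith
  have hpow : ∀ (k : ℕ) (s : ℝ), ((2 : ℝ) ^ k) ^ s = ((2 : ℝ) ^ s) ^ k := fun k s => by
    rw [← Real.rpow_natCast, ← Real.rpow_natCast, ← Real.rpow_mul (by norm_num),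
      ← Real.rpow_mul (by norm_num), mul_comm]
  refine ⟨K * 4 ^ β * (r / (r - 1)), by positivity, fun M N b hb => ?_⟩
  have hb' := mem_slice.1 hb
  set B := (slice F M N).filter (b ≠ ·) with hB
  set L : ℕ := (N - M).toNat with hL
  have hL0 : L ≠ 0 := by omega
  have hLc : ((N - M : ℤ) : ℝ) = (L : ℝ) := by
    have : N - M = (L : ℤ) := by omega
    rw [this]; simp
  have hmaps : ∀ b' ∈ B, Nat.log 2 (b - b').natAbs ∈ Finset.range (Nat.log 2 L + 1) := by
    intro b' hb1
    have := mem_slice.1 (Finset.mem_filter.1 hb1).1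
    exact Finset.mem_range.2 (Nat.lt_succ_of_le (Nat.log_mono_right (by omega)))
  rw [← Finset.sum_fiberwise_of_maps_to hmaps]
  have hshell : ∀ k : ℕ, ∑ b' ∈ B with Nat.log 2 (b - b').natAbs = k,
      ((|b - b'| : ℤ) : ℝ) ^ (α - 1) ≤ K * 4 ^ β * r ^ k := by
    intro k
    set Bk := B.filter (fun b' => Nat.log 2 (b - b').natAbs = k) with hBk
    have hterm : ∀ b' ∈ Bk, ((|b - b'| : ℤ) : ℝ) ^ (α - 1) ≤ ((2 : ℝ) ^ k) ^ (α - 1) := by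
      intro b' h
      rw [hBk, hB, Finset.mem_filter, Finset.mem_filter] at h
      have h0 : (b - b').natAbs ≠ 0 := Int.natAbs_ne_zero.2 (sub_ne_zero.2 h.1.2)
      have h1 : 2 ^ k ≤ (b - b').natAbs := h.2 ▸ Nat.pow_log_le_self 2 h0
      have h2 : (2 : ℝ) ^ k ≤ ((|b - b'| : ℤ) : ℝ) := by
        rw [Int.abs_eq_natAbs]
        exact_mod_cast h1
      exact Real.rpow_le_rpow_of_nonpos (by positivity) h2 (by linarith)
    have hcard : (Bk.card : ℝ) ≤ K * ((2 : ℝ) ^ k * 4) ^ β := by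
      have hsub : Bk ⊆ slice F (b - 2 ^ (k + 1)) (b + 2 ^ (k + 1)) := by
        intro b' h
        rw [hBk, hB, Finset.mem_filter, Finset.mem_filter] at h
        have h1 : (b - b').natAbs < 2 ^ (k + 1) :=
          h.2 ▸ Nat.lt_pow_succ_log_self (by norm_num) _
        have h2 : |b - b'| < 2 ^ (k + 1) := by
          rw [Int.abs_eq_natAbs]
          exact_mod_cast h1
        rw [abs_lt] at h2
        exact mem_slice.2 ⟨by constructor <;> linarith, (mem_slice.1 h.1.1).2⟩
      refine (Nat.cast_le.2 (Finset.card_le_card hsub)).trans ((hK _ _ ?_).trans (le_of_eq ?_))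
      · have : (0 : ℤ) < 2 ^ (k + 1) := by positivity
        linarith
      · push_cast
        congr 2
        ring
    calc ∑ b' ∈ Bk, ((|b - b'| : ℤ) : ℝ) ^ (α - 1)
        ≤ Bk.card • ((2 : ℝ) ^ k) ^ (α - 1) := Finset.sum_le_card_nsmul _ _ _ hterm
      _ ≤ K * ((2 : ℝ) ^ k * 4) ^ β * ((2 : ℝ) ^ k) ^ (α - 1) := by
        rw [nsmul_eq_mul]
        gcongr
      _ = K * 4 ^ β * (((2 : ℝ) ^ k) ^ β * ((2 : ℝ) ^ k) ^ (α - 1)) := by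
        rw [Real.mul_rpow (by positivity) (by norm_num)]
        ring
      _ = K * 4 ^ β * r ^ k := by
        rw [← Real.rpow_add (by positivity), hpow, hr,
          show β + (α - 1) = α + β - 1 by ring]
  calc _ ≤ ∑ k ∈ Finset.range (Nat.log 2 L + 1), K * 4 ^ β * r ^ k :=
        Finset.sum_le_sum fun k _ => hshell k
    _ = K * 4 ^ β * ∑ k ∈ Finset.range (Nat.log 2 L + 1), r ^ k := by rw [Finset.mul_sum]
    _ ≤ K * 4 ^ β * (r / (r - 1) * r ^ Nat.log 2 L) := by
        gcongr
        exact geom_sum_le_mul_pow hr1 _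
    _ ≤ K * 4 ^ β * (r / (r - 1) * (L : ℝ) ^ (α + β - 1)) := by
        have : r ^ Nat.log 2 L ≤ (L : ℝ) ^ (α + β - 1) := by
          rw [hr, ← hpow]
          refine Real.rpow_le_rpow (by positivity) ?_ (by linarith)
          exact_mod_cast Nat.pow_log_le_self 2 hL0
        gcongr
    _ = _ := by rw [hLc]; ring

lemma exists_lintegral_card_collisions_le {E F : Set ℤ} {α β K₁ K₂ : ℝ} (hα : 0 ≤ α)
    (hα1 : α ≤ 1) (hαβ : 1 < α + β)
    (hK₁ : ∀ M N : ℤ, M < N → ((slice E M N).card : ℝ) ≤ K₁ * ((N - M : ℤ) : ℝ) ^ α)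
    (hK₁0 : 0 < K₁)
    (hK₂ : ∀ M N : ℤ, M < N → ((slice F M N).card : ℝ) ≤ K₂ * ((N - M : ℤ) : ℝ) ^ β)
    (hK₂0 : 0 < K₂) (Λ : ℕ) :
    ∃ C : ℝ, 0 < C ∧ ∀ a b c d : ℤ, a < b → c < d →
      ∫⁻ l in Set.Icc (-(Λ : ℝ)) Λ,
          ((collisions (slice E a b ×ˢ slice F c d) (addFloor l)).card : ℝ≥0∞) ≤
        ENNReal.ofReal (C * ((b - a : ℤ) : ℝ) ^ α * ((d - c : ℤ) : ℝ) ^ β *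
          ((d - c : ℤ) : ℝ) ^ (α + β - 1)) := by
  obtain ⟨C, hC, hC'⟩ := sum_abs_rpow_le hα1 hαβ hK₂ hK₂0
  set C₁ : ℝ := 2 * K₁ * (2 * Λ + 1 : ℝ) ^ α with hC₁
  have hC₁0 : 0 < C₁ := by positivity
  refine ⟨K₁ * K₂ * (2 * Λ + C₁ * C), by positivity, fun a b c d hab hcd => ?_⟩
  refine (lintegral_card_collisions_le Λ _).trans (ENNReal.ofReal_le_ofReal ?_)
  set A := slice E a b
  set B := slice F c d
  have hN : (1 : ℝ) ≤ ((b - a : ℤ) : ℝ) := by exact_mod_cast (by omega : (1 : ℤ) ≤ b - a)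
  have hL : (1 : ℝ) ≤ ((d - c : ℤ) : ℝ) := by exact_mod_cast (by omega : (1 : ℤ) ≤ d - c)
  set N : ℝ := ((b - a : ℤ) : ℝ)
  set L : ℝ := ((d - c : ℤ) : ℝ)
  have hLγ : 1 ≤ L ^ (α + β - 1) := Real.one_le_rpow hL (by linarith)
  have hrow : ∀ x ∈ A ×ˢ B, ∑ y ∈ A ×ˢ B, collisionWeight Λ x y ≤
      (2 * Λ + C₁ * C) * L ^ (α + β - 1) := by
    intro x hx
    have hx' := Finset.mem_product.1 hx
    have hdiag : ∑ b' ∈ B with x.2 = b', ∑ a' ∈ A, collisionWeight Λ x (a', b') ≤ 2 * Λ := by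
      rw [Finset.filter_eq, if_pos hx'.2, Finset.sum_singleton]
      simp only [collisionWeight, if_true]
      rw [Finset.sum_ite_eq, if_pos hx'.1]
    have hoff : ∑ b' ∈ B with x.2 ≠ b', ∑ a' ∈ A, collisionWeight Λ x (a', b') ≤
        C₁ * (C * L ^ (α + β - 1)) := by
      refine (Finset.sum_le_sum fun b' hb' => sum_collisionWeight_fiber_le hα hK₁ hK₁0 Λ a b x
        (Finset.mem_filter.1 hb').2).trans ?_
      rw [← Finset.mul_sum]
      exact mul_le_mul_of_nonneg_left (hC' c d x.2 hx'.2) hC₁0.le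
    rw [Finset.sum_product_right, ← Finset.sum_filter_add_sum_filter_not B (x.2 = ·)]
    refine (add_le_add hdiag hoff).trans ?_
    have : 2 * (Λ : ℝ) * 1 ≤ 2 * Λ * L ^ (α + β - 1) := by gcongr
    linarith
  calc ∑ x ∈ A ×ˢ B, ∑ y ∈ A ×ˢ B, collisionWeight Λ x y
      ≤ (A ×ˢ B).card • ((2 * Λ + C₁ * C) * L ^ (α + β - 1)) :=
        Finset.sum_le_card_nsmul _ _ _ hrow
    _ = A.card * B.card * ((2 * Λ + C₁ * C) * L ^ (α + β - 1)) := by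
        rw [nsmul_eq_mul, Finset.card_product]
        push_cast
        rfl
    _ ≤ (K₁ * N ^ α) * (K₂ * L ^ β) * ((2 * Λ + C₁ * C) * L ^ (α + β - 1)) := by
        have h1 := hK₁ a b hab
        have h2 := hK₂ c d hcd
        gcongr
    _ = _ := by ring

lemma ae_frequently_le {X : Type*} [MeasurableSpace X] {μ : Measure X} {f : ℕ → X → ℝ≥0∞}
    (hf : ∀ n, Measurable (f n)) {C : ℝ≥0∞} (hC : C ≠ ⊤) (h : ∀ n, ∫⁻ x, f n x ∂μ ≤ C) :
    ∀ᵐ x ∂μ, ∃ T : ℝ, 0 < T ∧ ∃ᶠ n in atTop, f n x ≤ ENNReal.ofReal T := by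
  have hfin : ∫⁻ x, liminf (fun n => f n x) atTop ∂μ ≠ ⊤ := by
    refine ne_top_of_le_ne_top hC ((lintegral_liminf_le hf).trans ?_)
    exact Filter.liminf_le_of_frequently_le' (Filter.Frequently.of_forall h)
  filter_upwards [ae_lt_top (Measurable.liminf hf) hfin] with x hx
  obtain ⟨T, hT, hT'⟩ := exists_between hx
  refine ⟨T.toReal, ENNReal.toReal_pos (bot_le.trans_lt hT).ne' hT'.ne, ?_⟩
  rw [ENNReal.ofReal_toReal hT'.ne]
  exact (Filter.frequently_lt_of_liminf_lt (by isBoundedDefault) hT).mono fun n hn => hn.le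

lemma image_addFloor_subset {E F : Set ℤ} {l : ℝ} {k : ℕ} (hk : |l| ≤ k) {a b c d : ℤ} :
    (((slice E a b ×ˢ slice F c d).image (addFloor l) : Finset ℤ) : Set ℤ) ⊆
      sumFloor E F l ∩ Set.Ioc (a + ⌊l * (c : ℝ)⌋ - k * (d - c))
        (b + ⌊l * (c : ℝ)⌋ + k * (d - c)) := by
  intro z hz
  obtain ⟨⟨x, y⟩, hxy, rfl⟩ := Finset.mem_image.1 (Finset.mem_coe.1 hz)
  obtain ⟨hx, hy⟩ := Finset.mem_product.1 hxy
  obtain ⟨hx1, hx2⟩ := mem_slice.1 hx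
  obtain ⟨hy1, hy2⟩ := mem_slice.1 hy
  simp only at hx1 hx2 hy1 hy2
  refine ⟨⟨x, hx2, y, hy2, rfl⟩, ?_⟩
  have hyc : |l * (y : ℝ) - l * (c : ℝ)| ≤ k * ((d - c : ℤ) : ℝ) := by
    rw [← mul_sub, abs_mul]
    have h1 : |(y : ℝ) - c| ≤ ((d - c : ℤ) : ℝ) := by
      have : |y - c| ≤ d - c := abs_le.2 (by constructor <;> linarith)
      exact_mod_cast this
    gcongr
  rw [abs_le] at hyc
  have hup : ⌊l * (y : ℝ)⌋ ≤ ⌊l * (c : ℝ)⌋ + k * (d - c) := by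
    rw [← Int.floor_add_intCast]
    apply Int.floor_mono
    push_cast at hyc ⊢
    linarith
  have hlo : ⌊l * (c : ℝ)⌋ - k * (d - c) ≤ ⌊l * (y : ℝ)⌋ := by
    rw [← Int.floor_sub_intCast]
    apply Int.floor_mono
    push_cast at hyc ⊢
    linarith
  simp only [addFloor, Set.mem_Ioc]
  constructor <;> linarith

/-- **Marstrand theorem for subsets of integers** (Theorem 1.1, density part).
If `E, F ⊆ ℤ` are regular compatible sets with `D(E) + D(F) > 1`, then for Lebesgue
almost every `λ ∈ ℝ` the sum `E + ⌊λ F⌋` has positive upper-Banach density. -/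
theorem marstrand_density (E F : Set ℤ) (hE : Regular E) (hF : Regular F)
    (hEF : Compatible E F) (hdim : 1 < countingDim E + countingDim F) :
    ∀ᵐ l : ℝ ∂(volume : Measure ℝ), 0 < upperBanach (sumFloor E F l) := by
  obtain ⟨a, b, c, d, hab, hcd, hmab, -, ⟨C, hC, hcomp⟩, ⟨c₁, hc₁, hE'⟩, ⟨c₂, hc₂, hF'⟩⟩ := hEF
  have hα1 := countingDim_le_one E
  have hβ1 := countingDim_le_one F
  have hE2 := hE.2
  have hF2 := hF.2
  set α := countingDim E
  set β := countingDim F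
  have hα : 0 < α := by linarith
  have hβ : 0 < β := by linarith
  obtain ⟨K₁, hK₁0, hK₁⟩ := exists_card_slice_le hα.le hE2
  obtain ⟨K₂, hK₂0, hK₂⟩ := exists_card_slice_le hβ.le hF2
  suffices h : ∀ Λ : ℕ, ∀ᵐ l : ℝ ∂(volume : Measure ℝ), l ∈ Set.Icc (-(Λ : ℝ)) Λ →
      0 < upperBanach (sumFloor E F l) by
    filter_upwards [ae_all_iff.2 h] with l hl
    obtain ⟨Λ, hΛ⟩ := exists_nat_ge |l|
    exact hl Λ (abs_le.1 hΛ)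
  intro Λ
  rw [← ae_restrict_iff' measurableSet_Icc]
  obtain ⟨C₁, hC₁0, hC₁⟩ :=
    exists_lintegral_card_collisions_le hα.le hα1 hdim hK₁ hK₁0 hK₂ hK₂0 Λ
  set N : ℕ → ℝ := fun n => ((b n - a n : ℤ) : ℝ) with hN
  set L : ℕ → ℝ := fun n => ((d n - c n : ℤ) : ℝ) with hL
  have hN1 : ∀ n, 1 ≤ N n := fun n => by
    simp only [hN]
    exact_mod_cast (by have := hab n; omega : (1 : ℤ) ≤ b n - a n)
  have hL1 : ∀ n, 1 ≤ L n := fun n => by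
    simp only [hL]
    exact_mod_cast (by have := hcd n; omega : (1 : ℤ) ≤ d n - c n)
  have hN0 : ∀ n, 0 < N n := fun n => by linarith [hN1 n]
  have hL0 : ∀ n, 0 < L n := fun n => by linarith [hL1 n]
  set W : ℕ → ℝ := fun n => N n ^ α * L n ^ β * L n ^ (α + β - 1) with hW
  have hW0 : ∀ n, 0 < W n := fun n => by
    have := hN0 n
    have := hL0 n
    positivity
  set G : ℕ → ℝ → ℕ := fun n l =>
    (collisions (slice E (a n) (b n) ×ˢ slice F (c n) (d n)) (addFloor l)).card with hG
  have hae := ae_frequently_le (μ := volume.restrict (Set.Icc (-(Λ : ℝ)) Λ))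
    (f := fun n l => (G n l : ℝ≥0∞) * ENNReal.ofReal (W n)⁻¹)
    (fun n => (measurable_card_collisions _).mul_const _) (C := ENNReal.ofReal C₁)
    ENNReal.ofReal_ne_top (fun n => by
      rw [lintegral_mul_const _ (measurable_card_collisions _)]
      refine (mul_le_mul_left (hC₁ _ _ _ _ (hab n) (hcd n)) _).trans ?_
      have h0 := hW0 n
      have h1 : C₁ * N n ^ α * L n ^ β * L n ^ (α + β - 1) = C₁ * W n := by
        simp only [hW]; ring
      change ENNReal.ofReal (C₁ * N n ^ α * L n ^ β * L n ^ (α + β - 1)) * _ ≤ _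
      rw [h1, ← ENNReal.ofReal_mul (by positivity), mul_assoc, mul_inv_cancel₀ h0.ne', mul_one])
  filter_upwards [hae] with l ⟨T, hT, hfreq⟩
  obtain ⟨k, hk⟩ := exists_nat_ge |l|
  have hD : 0 < 1 + 2 * k * C := by positivity
  refine upperBanach_pos (u := fun n => a n + ⌊l * (c n : ℝ)⌋ - k * (d n - c n))
    (v := fun n => b n + ⌊l * (c n : ℝ)⌋ + k * (d n - c n))
    (c := c₁ ^ 2 * c₂ ^ 2 / (T * C ^ (1 - α)) / (1 + 2 * k * C))
    (by positivity) ?_ ?_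
  · refine tendsto_atTop_mono (f := fun n => b n - a n) (fun n => ?_) ?_
    · have : 0 ≤ (k : ℤ) * (d n - c n) := mul_nonneg (by positivity) (by linarith [hcd n])
      linarith
    · refine tendsto_atTop_mono (f := fun n : ℕ => (n : ℤ)) (fun n => ?_)
        tendsto_natCast_atTop_atTop
      induction n with
      | zero => simpa using (hab 0).le
      | succ n ih =>
        have := hmab (Nat.lt_succ_self n)
        push_cast
        simp only [Nat.succ_eq_add_one] at this ih
        omega
  · refine hfreq.mono fun n hn => ?_
    have hWn := hW0 n
    have hNn := hN0 n
    have hLn := hL0 n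
    have hGn : (G n l : ℝ) ≤ T * W n := by
      rw [← ENNReal.ofReal_natCast, ← ENNReal.ofReal_mul (by positivity),
        ENNReal.ofReal_le_ofReal_iff hT.le, ← div_eq_mul_inv, div_le_iff₀ hWn] at hn
      exact hn
    set S := (slice E (a n) (b n) ×ˢ slice F (c n) (d n)).image (addFloor l) with hS
    have hcs : ((slice E (a n) (b n)).card * (slice F (c n) (d n)).card : ℝ) ^ 2 ≤
        S.card * G n l := by
      have := card_sq_le_card_image_mul_card_collisions
        (slice E (a n) (b n) ×ˢ slice F (c n) (d n)) (addFloor l)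
      rw [Finset.card_product] at this
      exact_mod_cast this
    have hA : c₁ * N n ^ α ≤ (slice E (a n) (b n)).card := icount_eq_card_slice E _ _ ▸ hE' n
    have hB : c₂ * L n ^ β ≤ (slice F (c n) (d n)).card := icount_eq_card_slice F _ _ ▸ hF' n
    have hSle : (S.card : ℝ) ≤ icount (sumFloor E F l) (a n + ⌊l * (c n : ℝ)⌋ - k * (d n - c n))
        (b n + ⌊l * (c n : ℝ)⌋ + k * (d n - c n)) := by
      rw [icount, ← Set.ncard_coe_finset]
      exact_mod_cast Set.ncard_le_ncard (image_addFloor_subset hk)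
        ((Set.finite_Ioc _ _).subset Set.inter_subset_right)
    have hlow : (c₁ * N n ^ α * (c₂ * L n ^ β)) ^ 2 ≤ S.card * (T * W n) := by
      refine le_trans ?_ (hcs.trans (by gcongr))
      gcongr
    have hNL : N n ^ (1 - α) ≤ C ^ (1 - α) * L n ^ (1 - α) := by
      rw [← Real.mul_rpow hC.le hLn.le]
      exact Real.rpow_le_rpow hNn.le (hcomp n).1 (by linarith)
    have hmain : c₁ ^ 2 * c₂ ^ 2 * N n ≤ S.card * (T * C ^ (1 - α)) := by
      have e1 : L n ^ (α + β - 1) * L n ^ (1 - α) = L n ^ β := by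
        rw [← Real.rpow_add hLn]
        congr 1
        ring
      have e2 : N n ^ α * N n ^ (1 - α) = N n := by
        rw [← Real.rpow_add hNn]
        simp
      refine le_of_mul_le_mul_right ?_ (by positivity : 0 < N n ^ α * (L n ^ β) ^ 2)
      calc c₁ ^ 2 * c₂ ^ 2 * N n * (N n ^ α * (L n ^ β) ^ 2)
          = (c₁ * N n ^ α * (c₂ * L n ^ β)) ^ 2 * N n ^ (1 - α) := by
            nth_rw 1 [← e2]
            ring
        _ ≤ S.card * (T * W n) * (C ^ (1 - α) * L n ^ (1 - α)) := by gcongr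
        _ = S.card * (T * C ^ (1 - α)) * (N n ^ α * L n ^ β *
              (L n ^ (α + β - 1) * L n ^ (1 - α))) := by
            simp only [hW]
            ring
        _ = S.card * (T * C ^ (1 - α)) * (N n ^ α * (L n ^ β) ^ 2) := by
            rw [e1]
            ring
    have hlen : ((b n + ⌊l * (c n : ℝ)⌋ + k * (d n - c n) -
        (a n + ⌊l * (c n : ℝ)⌋ - k * (d n - c n)) : ℤ) : ℝ) ≤ (1 + 2 * k * C) * N n := by
      have h1 : (k : ℝ) * L n ≤ k * (C * N n) :=
        mul_le_mul_of_nonneg_left (hcomp n).2 (by positivity)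
      simp only [hN, hL] at h1 ⊢
      push_cast at h1 ⊢
      linarith
    refine le_trans ?_ hSle
    calc _ ≤ c₁ ^ 2 * c₂ ^ 2 / (T * C ^ (1 - α)) / (1 + 2 * k * C) * ((1 + 2 * k * C) * N n) := by
          gcongr
      _ = c₁ ^ 2 * c₂ ^ 2 * N n / (T * C ^ (1 - α)) := by
          field_simp
      _ ≤ S.card := (div_le_iff₀ (by positivity)).2 hmain
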